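/- Let S be a pseudo-nilpotent finite semigroup with principal series. Every stem S^{(i)} (for S_i \ S_{i+1} a root) is a subsemigroup of S, and for two non-isolated principal factor complements, (S_i \ S_{i+1})(S_j \ S_{j+1}) ⊆ K if and only if S_i \ S_{i+1} and S_j \ S_{j+1} are not contained in a common stem, where K is the largest nilpotent ideal. -/

import Mathlib

/-- One multiplication step `a · w · b` where `w` ranges over `S¹`
(`none` playing the role of the adjoined identity). -/
def mulW {S : Type*} [Semigroup S] (a : S) (w : Option S) (b : S) : S :=
  match w with
  | none => a * b
  | some c => a * c * b

/-- The Mal'cev sequences: `(malcev x y w n).1 = λ_n` and `(malcev x y w n).2 = ρ_n`,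
with `λ_0 = x`, `ρ_0 = y`, `λ_{n+1} = λ_n w_{n+1} ρ_n`, `ρ_{n+1} = ρ_n w_{n+1} λ_n`. -/
def malcev {S : Type*} [Semigroup S] (x y : S) (w : ℕ → Option S) : ℕ → S × S
  | 0 => (x, y)
  | n + 1 =>
      let p := malcev x y w n
      (mulW p.1 (w n) p.2, mulW p.2 (w n) p.1)

/-- Mal'cev nilpotency of a (multiplicatively closed) subset `A` of `S`,
computed with parameters from `A¹`. -/
def SetMN {S : Type*} [Semigroup S] (A : Set S) : Prop :=
  ∃ n : ℕ, 0 < n ∧ ∀ x ∈ A, ∀ y ∈ A, ∀ w : ℕ → Option S,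
    (∀ k c, w k = some c → c ∈ A) →
    (malcev x y w n).1 = (malcev x y w n).2

/-- A semigroup is Mal'cev nilpotent. -/
def IsMN (S : Type*) [Semigroup S] : Prop := SetMN (Set.univ : Set S)

/-- Equality in the Rees quotient by (the possibly empty ideal) `I`. -/
def ReesEq {S : Type*} [Semigroup S] (I : Set S) (a b : S) : Prop :=
  a = b ∨ (a ∈ I ∧ b ∈ I)

/-- Mal'cev nilpotency of the Rees quotient `A / I` (computed by lifting to `A`). -/
def SetMNMod {S : Type*} [Semigroup S] (I A : Set S) : Prop :=
  ∃ n : ℕ, 0 < n ∧ ∀ x ∈ A, ∀ y ∈ A, ∀ w : ℕ → Option S,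
    (∀ k c, w k = some c → c ∈ A) →
    ReesEq I (malcev x y w n).1 (malcev x y w n).2

/-- `I` is an ideal of (the mul-closed subset) `T`; the empty set counts as an ideal. -/
def IsIdealIn {S : Type*} [Semigroup S] (T I : Set S) : Prop :=
  I ⊆ T ∧ ∀ a ∈ I, ∀ t ∈ T, t * a ∈ I ∧ a * t ∈ I

/-- Edge of the upper non-nilpotent graph `N_S`: `⟨a,b⟩` is not Mal'cev nilpotent. -/
def NEdge {S : Type*} [Semigroup S] (a b : S) : Prop :=
  a ≠ b ∧ ¬ SetMN (Subsemigroup.closure ({a, b} : Set S) : Set S)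

/-- The generating set of the subsemigroup `⟨x, y, w_1, …, w_m⟩`. -/
def genSet {S : Type*} [Semigroup S] (x y : S) (w : ℕ → Option S) (m : ℕ) : Set S :=
  {x, y} ∪ {c | ∃ k, k < m ∧ w k = some c}

/-- A pseudo-nilpotent semigroup. -/
def IsPN (S : Type*) [Semigroup S] : Prop :=
  ∀ (x y : S) (w : ℕ → Option S) (m : ℕ) (I : Set S),
    IsIdealIn (Subsemigroup.closure (genSet x y w m) : Set S) I →
    (malcev x y w m).1 ∉ I → (malcev x y w m).2 ∉ I →
    (∃ t, t < m ∧ (malcev x y w t).1 ≠ (malcev x y w t).2 ∧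
      malcev x y w t = malcev x y w m) →
    ∀ i ≤ m, ¬ SetMNMod I
      (Subsemigroup.closure ({(malcev x y w i).1, (malcev x y w i).2} : Set S) : Set S)

/-- A principal series `S = S_1 ⊃ S_2 ⊃ ⋯ ⊃ S_m ⊃ S_{m+1} = ∅` of a semigroup:
a strictly decreasing chain of ideals with no ideal strictly between consecutive
terms (the empty set counts as an ideal). -/
structure PrincipalSeries (S : Type*) [Semigroup S] where
  m : ℕ
  C : ℕ → Set S
  first : C 1 = Set.univ
  last : C (m + 1) = ∅
  ideal : ∀ i, 1 ≤ i → i ≤ m → IsIdealIn Set.univ (C i)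
  ssub : ∀ i, 1 ≤ i → i ≤ m → C (i + 1) ⊂ C i
  maximal : ∀ i, 1 ≤ i → i ≤ m → ∀ I : Set S, IsIdealIn Set.univ I →
    C (i + 1) ⊆ I → I ⊆ C i → I = C (i + 1) ∨ I = C i

variable {S : Type*} [Semigroup S]

/-- `F_{S_j/S_{j+1}}(S/S_{j+1})`, computed in `S`:  the elements `s ∉ S_j` with
`s·a ≠ θ` or `a·s ≠ θ` in `S/S_{j+1}` for some `a` in the ideal `S_j/S_{j+1}`. -/
def FsetQ (ps : PrincipalSeries S) (j : ℕ) : Set S :=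
  {s | s ∉ ps.C j ∧ ∃ a ∈ ps.C j, s * a ∉ ps.C (j + 1) ∨ a * s ∉ ps.C (j + 1)}

/-- `S_i \ S_{i+1}` is a root: the principal factor `S_i/S_{i+1}` is not Mal'cev
nilpotent and there is no `N_S`-edge between `S_i \ S_{i+1}` and `S_{i+1}`. -/
def Root (ps : PrincipalSeries S) (i : ℕ) : Prop :=
  ¬ SetMNMod (ps.C (i + 1)) (ps.C i) ∧
  ∀ a ∈ ps.C i \ ps.C (i + 1), ∀ b ∈ ps.C (i + 1), ¬ NEdge a b

/-- `S_i \ S_{i+1}` is an isolated subset: it is not a root, and whenever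
`S_i \ S_{i+1} ⊆ F_{S_j/S_{j+1}}(S/S_{j+1})` the factor `S_j/S_{j+1}` is nilpotent. -/
def Isolated (ps : PrincipalSeries S) (i : ℕ) : Prop :=
  ¬ Root ps i ∧
  ∀ j, 1 ≤ j → j ≤ ps.m → ps.C i \ ps.C (i + 1) ⊆ FsetQ ps j →
    SetMNMod (ps.C (j + 1)) (ps.C j)

/-- `K`, the union of all isolated subsets `S_i \ S_{i+1}`. -/
def Kset (ps : PrincipalSeries S) : Set S :=
  {a | ∃ i, 1 ≤ i ∧ i ≤ ps.m ∧ Isolated ps i ∧ a ∈ ps.C i \ ps.C (i + 1)}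

/-- The stem `S^{(i)} = F_{S_i/S_{i+1}}(S/S_{i+1}) ∪ (S_i \ S_{i+1})` of a root. -/
def Stem (ps : PrincipalSeries S) (i : ℕ) : Set S :=
  FsetQ ps i ∪ (ps.C i \ ps.C (i + 1))

/-- The Mal'cev sequences of a monoid `M`, with the parameters taken in `M`. -/
def malcevMonoid {M : Type*} [Monoid M] (x y : M) (w : ℕ → M) : ℕ → M × M
  | 0 => (x, y)
  | n + 1 =>
      ((malcevMonoid x y w n).1 * w n * (malcevMonoid x y w n).2,
        (malcevMonoid x y w n).2 * w n * (malcevMonoid x y w n).1)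

/-- `T / I` is a principal factor of the monoid `M`: both are ideals, and any two elements
of `T \ I` generate the same ideal of `M`. -/
structure IsPrincipalFactor {M : Type*} [Monoid M] (T I : Set M) : Prop where
  left_T : ∀ a ∈ T, ∀ u, u * a ∈ T
  right_T : ∀ a ∈ T, ∀ u, a * u ∈ T
  left_I : ∀ a ∈ I, ∀ u, u * a ∈ I
  right_I : ∀ a ∈ I, ∀ u, a * u ∈ I
  rel : ∀ a ∈ T \ I, ∀ b ∈ T \ I, ∃ u v, a = u * b * v

/-- The pair `x, y` starts a Mal'cev sequence that stays in `J` and whose two components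
always differ. -/
def StartsCycle {M : Type*} [Monoid M] (J : Set M) (x y : M) : Prop :=
  ∃ w : ℕ → M, ∀ n, (malcevMonoid x y w n).1 ≠ (malcevMonoid x y w n).2 ∧
    (malcevMonoid x y w n).1 ∈ J ∧ (malcevMonoid x y w n).2 ∈ J

theorem malcevMonoid_op {M : Type*} [Monoid M] (x y : M) (w : ℕ → M) (n : ℕ) :
    malcevMonoid (MulOpposite.op x) (MulOpposite.op y) (fun k => MulOpposite.op (w k)) n =
      (MulOpposite.op (malcevMonoid x y w n).1, MulOpposite.op (malcevMonoid x y w n).2) ∨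
    malcevMonoid (MulOpposite.op x) (MulOpposite.op y) (fun k => MulOpposite.op (w k)) n =
      (MulOpposite.op (malcevMonoid x y w n).2, MulOpposite.op (malcevMonoid x y w n).1) := by
  induction n with
  | zero => simp [malcevMonoid]
  | succ n ih =>
    rcases ih with ih | ih <;> simp [malcevMonoid, ih, ← MulOpposite.op_mul, mul_assoc]

theorem StartsCycle.op {M : Type*} [Monoid M] {J : Set M} {x y : M} (h : StartsCycle J x y) :
    StartsCycle (MulOpposite.unop ⁻¹' J) (MulOpposite.op x) (MulOpposite.op y) := by
  obtain ⟨w, hw⟩ := h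
  refine ⟨fun k => MulOpposite.op (w k), fun n => ?_⟩
  obtain ⟨h1, h2, h3⟩ := hw n
  rcases malcevMonoid_op x y w n with e | e <;> rw [e]
  · exact ⟨fun h => h1 (MulOpposite.op_injective h), h2, h3⟩
  · exact ⟨fun h => h1 (MulOpposite.op_injective h).symm, h3, h2⟩

theorem malcevMonoid_unop {M : Type*} [Monoid M] (x y : Mᵐᵒᵖ) (w : ℕ → Mᵐᵒᵖ) (n : ℕ) :
    malcevMonoid x.unop y.unop (fun k => (w k).unop) n =
      ((malcevMonoid x y w n).1.unop, (malcevMonoid x y w n).2.unop) ∨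
    malcevMonoid x.unop y.unop (fun k => (w k).unop) n =
      ((malcevMonoid x y w n).2.unop, (malcevMonoid x y w n).1.unop) := by
  induction n with
  | zero => simp [malcevMonoid]
  | succ n ih =>
    rcases ih with ih | ih <;> simp [malcevMonoid, ih, mul_assoc]

theorem StartsCycle.unop {M : Type*} [Monoid M] {J : Set M} {x y : Mᵐᵒᵖ}
    (h : StartsCycle (MulOpposite.unop ⁻¹' J) x y) : StartsCycle J x.unop y.unop := by
  obtain ⟨w, hw⟩ := h
  refine ⟨fun k => (w k).unop, fun n => ?_⟩
  obtain ⟨h1, h2, h3⟩ := hw n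
  rcases malcevMonoid_unop x y w n with e | e <;> rw [e]
  · exact ⟨fun h => h1 (MulOpposite.unop_injective h), h2, h3⟩
  · exact ⟨fun h => h1 (MulOpposite.unop_injective h).symm, h3, h2⟩

theorem malcevMonoid_swap {M : Type*} [Monoid M] (x y : M) (w : ℕ → M) (n : ℕ) :
    malcevMonoid y x w n = (malcevMonoid x y w n).swap := by
  induction n with
  | zero => rfl
  | succ n ih => simp [malcevMonoid, ih]

theorem StartsCycle.symm {M : Type*} [Monoid M] {J : Set M} {x y : M}
    (h : StartsCycle J x y) : StartsCycle J y x := by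
  obtain ⟨w, hw⟩ := h
  refine ⟨w, fun n => ?_⟩
  obtain ⟨h1, h2, h3⟩ := hw n
  rw [malcevMonoid_swap]
  exact ⟨h1.symm, h3, h2⟩

namespace IsPrincipalFactor

variable {M : Type*} [Monoid M] {T I : Set M}

theorem op (h : IsPrincipalFactor T I) :
    IsPrincipalFactor (MulOpposite.unop ⁻¹' T) (MulOpposite.unop ⁻¹' I) where
  left_T a ha u := h.right_T _ ha _
  right_T a ha u := h.left_T _ ha _
  left_I a ha u := h.right_I _ ha _
  right_I a ha u := h.left_I _ ha _
  rel a ha b hb := by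
    obtain ⟨u, v, e⟩ := h.rel a.unop ha b.unop hb
    exact ⟨MulOpposite.op v, MulOpposite.op u, MulOpposite.unop_injective (by simp [e, mul_assoc])⟩

theorem exists_mul_right [Finite M] (h : IsPrincipalFactor T I) {a s : M} (ha : a ∈ T \ I)
    (has : a * s ∈ T \ I) : ∃ t, a * s * t = a := by
  obtain ⟨u, v, e⟩ := h.rel a ha _ has
  have key : ∀ n : ℕ, u ^ n * a * (s * v) ^ n = a := by
    intro n
    induction n with
    | zero => simp
    | succ n ih =>
      calc u ^ (n + 1) * a * (s * v) ^ (n + 1)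
          = u ^ n * (u * (a * s) * v) * (s * v) ^ n := by
            rw [pow_succ u, pow_succ' (s * v)]; simp only [mul_assoc]
        _ = a := by rw [← e, ih]
  obtain ⟨n, m, hnm, hp⟩ : ∃ n m : ℕ, n < m ∧ (s * v) ^ n = (s * v) ^ m := by
    obtain ⟨n, m, hne, hp⟩ := Finite.exists_ne_map_eq_of_infinite (fun n : ℕ => (s * v) ^ n)
    rcases lt_or_gt_of_ne hne with hlt | hlt
    · exact ⟨n, m, hlt, hp⟩
    · exact ⟨m, n, hlt, hp.symm⟩
  obtain ⟨k, rfl⟩ := Nat.exists_eq_add_of_lt hnm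
  refine ⟨v * (s * v) ^ k, ?_⟩
  calc a * s * (v * (s * v) ^ k) = u ^ n * a * (s * v) ^ n * (s * v) ^ (k + 1) := by
        rw [key, pow_succ']; simp only [mul_assoc]
    _ = a := by rw [mul_assoc, ← pow_add, ← add_assoc, ← hp, key]

theorem exists_mul_left [Finite M] (h : IsPrincipalFactor T I) {a s : M} (ha : a ∈ T \ I)
    (has : s * a ∈ T \ I) : ∃ t, t * (s * a) = a := by
  have : Finite Mᵐᵒᵖ := Finite.of_injective _ MulOpposite.unop_injective
  obtain ⟨t, e⟩ := h.op.exists_mul_right (a := MulOpposite.op a) (s := MulOpposite.op s) ha has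
  exact ⟨t.unop, MulOpposite.op_injective (by simpa using e)⟩

theorem mul_mul_mem [Finite M] (h : IsPrincipalFactor T I) {a b c : M} (hb : b ∈ T \ I)
    (hab : a * b ∈ T \ I) (hbc : b * c ∈ T \ I) : a * b * c ∈ T \ I := by
  obtain ⟨t, e⟩ := h.exists_mul_right hb hbc
  refine ⟨h.right_T _ hab.1 _, fun hI => hab.2 ?_⟩
  have := h.right_I _ hI t
  rwa [mul_assoc, mul_assoc, ← mul_assoc b, e] at this

theorem mem_of_mul_left (h : IsPrincipalFactor T I) {a b : M} (hb : b ∈ T)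
    (hab : a * b ∈ T \ I) : b ∈ T \ I :=
  ⟨hb, fun hI => hab.2 (h.left_I _ hI _)⟩

theorem mem_of_mul_right (h : IsPrincipalFactor T I) {a b : M} (ha : a ∈ T)
    (hab : a * b ∈ T \ I) : a ∈ T \ I :=
  ⟨ha, fun hI => hab.2 (h.right_I _ hI _)⟩

/-- Any two elements of `T \ I` have an element that is `ℒ`-related to the first and
`ℛ`-related to the second. -/
theorem exists_between [Finite M] (h : IsPrincipalFactor T I) {a b : M} (ha : a ∈ T \ I)
    (hb : b ∈ T \ I) :
    ∃ c ∈ T \ I, (∃ r, c = r * a) ∧ (∃ p, p * c = a) ∧ (∃ v, c * v = b) ∧ ∃ t, b * t = c := by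
  obtain ⟨r, v, e⟩ := h.rel b hb a ha
  have hc : r * a ∈ T \ I := h.mem_of_mul_right (h.left_T _ ha.1 _) (e ▸ hb)
  refine ⟨r * a, hc, ⟨r, rfl⟩, h.exists_mul_left ha hc, ⟨v, e.symm⟩, ?_⟩
  rw [e]
  exact h.exists_mul_right hc (e ▸ hb)

/-- Translating a cycle whose two entries are `ℛ`-related. -/
theorem startsCycle_translate (h : IsPrincipalFactor T I) {x y u d r : M}
    (hc : StartsCycle (T \ I) x y) (hu : y = x * u) (hd : d * (r * x) = x) :
    StartsCycle (T \ I) (r * x) (r * y) := by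
  obtain ⟨w, hw⟩ := hc
  have hx : ∀ n, (∃ z, (malcevMonoid x y w n).1 = x * z) ∧
      ∃ z, (malcevMonoid x y w n).2 = x * z := by
    intro n
    induction n with
    | zero => exact ⟨⟨1, by simp [malcevMonoid]⟩, ⟨u, hu⟩⟩
    | succ n ih =>
      obtain ⟨⟨z, e⟩, z', e'⟩ := ih
      simp only [malcevMonoid, e, e', mul_assoc]
      exact ⟨⟨_, rfl⟩, ⟨_, rfl⟩⟩
  have hd' : ∀ z, d * (r * (x * z)) = x * z := fun z => by
    rw [← mul_assoc r, ← mul_assoc, hd]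
  have hl : ∀ n, d * (r * (malcevMonoid x y w n).1) = (malcevMonoid x y w n).1 := fun n => by
    obtain ⟨⟨z, e⟩, -⟩ := hx n
    rw [e, hd']
  have hr : ∀ n, d * (r * (malcevMonoid x y w n).2) = (malcevMonoid x y w n).2 := fun n => by
    obtain ⟨-, z, e⟩ := hx n
    rw [e, hd']
  have key : ∀ n, malcevMonoid (r * x) (r * y) (fun k => w k * d) n =
      (r * (malcevMonoid x y w n).1, r * (malcevMonoid x y w n).2) := by
    intro n
    induction n with
    | zero => rfl
    | succ n ih => simp only [malcevMonoid, ih, mul_assoc, hl, hr]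
  refine ⟨fun k => w k * d, fun n => ?_⟩
  obtain ⟨h1, h2, h3⟩ := hw n
  rw [key]
  refine ⟨fun e => h1 ?_, ⟨h.left_T _ h2.1 _, fun hI => h2.2 ?_⟩,
    ⟨h.left_T _ h3.1 _, fun hI => h3.2 ?_⟩⟩
  · rw [← hl, ← hr]
    exact congrArg (d * ·) e
  · rw [← hl]
    exact h.left_I _ hI _
  · rw [← hr]
    exact h.left_I _ hI _

theorem mul_mem_of_startsCycle [Finite M] (h : IsPrincipalFactor T I)
    (HR : ∀ x y, StartsCycle (T \ I) x y → (∃ u, y = x * u) → x * x ∉ I)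
    {x y u : M} (hc : StartsCycle (T \ I) x y) (hu : y = x * u) :
    ∀ b ∈ T \ I, x * b ∈ T \ I := by
  intro b hb
  have hx : x ∈ T \ I := by
    obtain ⟨w, hw⟩ := hc
    exact (hw 0).2.1
  obtain ⟨c, hcJ, ⟨r, rfl⟩, ⟨d, hd⟩, ⟨v, hv⟩, -⟩ := h.exists_between hx hb
  have h1 := HR _ _ (h.startsCycle_translate hc hu hd) ⟨u, by rw [hu, mul_assoc]⟩
  have h2 : x * (r * x) ∈ T \ I := by
    refine ⟨h.right_T _ hx.1 _, fun hI => h1 ?_⟩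
    rw [mul_assoc]
    exact h.left_I _ hI r
  have h3 := h.mul_mul_mem hcJ h2 (hv.symm ▸ hb : r * x * v ∈ T \ I)
  rwa [mul_assoc, hv] at h3

/-- A constant parameter `s` for which all four products with `x` and `y` stay in `T \ I`
yields a cycle as soon as `x` and `y` are not `ℒ`-related. -/
theorem startsCycle_const [Finite M] (h : IsPrincipalFactor T I) {x y s : M}
    (hx : x ∈ T \ I) (hy : y ∈ T \ I) (hs : s ∈ T \ I)
    (hxs : x * s ∈ T \ I) (hys : y * s ∈ T \ I) (hsx : s * x ∈ T \ I) (hsy : s * y ∈ T \ I)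
    (hL : ¬ ∃ q, x = q * y) : StartsCycle (T \ I) x y := by
  let P : M → Prop := fun z => z ∈ T \ I ∧ z * s ∈ T \ I ∧ s * z ∈ T \ I
  have hP : ∀ z z', P z → P z' → P (z * s * z') := by
    rintro z z' ⟨h1, h2, h3⟩ ⟨h4, h5, h6⟩
    have h7 := h.mul_mul_mem hs h2 h6
    refine ⟨h7, ?_, ?_⟩
    · exact h.mul_mul_mem h4 h7 h5
    · have := h.mul_mul_mem h1 h3 (mul_assoc z s z' ▸ h7 : z * (s * z') ∈ T \ I)
      simpa only [mul_assoc] using this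
  let L : M → M → Prop := fun z z' => (∃ q, z = q * z') ∧ ∃ q, z' = q * z
  have hLL : ∀ t z z', P z → P z' → L t z' → L t (z * s * z') := by
    rintro t z z' hz hz' ⟨⟨q, rfl⟩, q', e'⟩
    obtain ⟨t, et⟩ := h.exists_mul_left hz'.1 (hP _ _ hz hz').1
    refine ⟨⟨q * t, ?_⟩, ⟨z * s * q', ?_⟩⟩
    · rw [mul_assoc, et]
    · rw [mul_assoc _ q', ← e']
  have key : ∀ n, P (malcevMonoid x y (fun _ => s) n).1 ∧ P (malcevMonoid x y (fun _ => s) n).2 ∧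
      ((L x (malcevMonoid x y (fun _ => s) n).1 ∧ L y (malcevMonoid x y (fun _ => s) n).2) ∨
        (L y (malcevMonoid x y (fun _ => s) n).1 ∧ L x (malcevMonoid x y (fun _ => s) n).2)) := by
    intro n
    induction n with
    | zero =>
      exact ⟨⟨hx, hxs, hsx⟩, ⟨hy, hys, hsy⟩,
        Or.inl ⟨⟨⟨1, (one_mul _).symm⟩, ⟨1, (one_mul _).symm⟩⟩,
          ⟨⟨1, (one_mul _).symm⟩, ⟨1, (one_mul _).symm⟩⟩⟩⟩
    | succ n ih =>
      obtain ⟨h1, h2, h3⟩ := ih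
      refine ⟨hP _ _ h1 h2, hP _ _ h2 h1, ?_⟩
      rcases h3 with ⟨h3, h4⟩ | ⟨h3, h4⟩
      · exact Or.inr ⟨hLL _ _ _ h1 h2 h4, hLL _ _ _ h2 h1 h3⟩
      · exact Or.inl ⟨hLL _ _ _ h1 h2 h4, hLL _ _ _ h2 h1 h3⟩
  refine ⟨fun _ => s, fun n => ?_⟩
  obtain ⟨h1, h2, h3⟩ := key n
  refine ⟨fun e => hL ?_, h1.1, h2.1⟩
  rw [e] at h3
  rcases h3 with ⟨⟨⟨q, h3⟩, -⟩, ⟨-, q', h4⟩⟩ | ⟨⟨-, q', h4⟩, ⟨⟨q, h3⟩, -⟩⟩ <;>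
    exact ⟨q * q', by rw [mul_assoc, ← h4, ← h3]⟩

theorem mul_mem_of_forall_mul_mem [Finite M] (h : IsPrincipalFactor T I)
    (HR : ∀ x y, StartsCycle (T \ I) x y → (∃ u, y = x * u) → x * x ∉ I)
    {x : M} (hx : x ∈ T \ I) (hxJ : ∀ b ∈ T \ I, x * b ∈ T \ I) :
    ∀ a ∈ T \ I, ∀ b ∈ T \ I, a * b ∈ T \ I := by
  intro a ha b hb
  by_cases hq : ∃ q, x = q * a
  · obtain ⟨q, rfl⟩ := hq
    have := hxJ b hb
    rw [mul_assoc] at this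
    exact h.mem_of_mul_left (h.right_T _ ha.1 _) this
  obtain ⟨c, hc, ⟨p, rfl⟩, -, ⟨v, hv⟩, t, ht⟩ := h.exists_between ha hx
  have hxx := hxJ x hx
  have h1 : a * (v * x) ∈ T \ I := by
    have : p * (a * (v * x)) ∈ T \ I := by
      rw [← hv] at hxx
      nth_rewrite 2 [hv] at hxx
      simpa only [mul_assoc] using hxx
    exact h.mem_of_mul_left (h.right_T _ ha.1 _) this
  have hs : v * x ∈ T \ I := h.mem_of_mul_left (h.left_T _ hx.1 _) h1
  have hsx : v * x * x ∈ T \ I := h.mul_mul_mem hx hs hxx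
  have hsc : v * x * (p * a) ∈ T \ I := by
    have := h.mul_mul_mem hx hsx (ht ▸ hc)
    rwa [mul_assoc, ht] at this
  have hcs : p * a * (v * x) ∈ T \ I := by rwa [← mul_assoc, hv]
  have hcyc : StartsCycle (T \ I) x (p * a) :=
    h.startsCycle_const hx hc hs (hxJ _ hs) hcs hsx hsc
      fun ⟨q, e⟩ => hq ⟨q * p, by rw [mul_assoc, ← e]⟩
  have := h.mul_mem_of_startsCycle HR hcyc.symm hv.symm b hb
  rw [mul_assoc] at this
  exact h.mem_of_mul_left (h.right_T _ ha.1 _) this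

theorem mul_mem_of_startsCycle_left [Finite M] (h : IsPrincipalFactor T I)
    (HL : ∀ x y, StartsCycle (T \ I) x y → (∃ u, y = u * x) → x * x ∉ I)
    {x y u : M} (hc : StartsCycle (T \ I) x y) (hu : y = u * x) :
    ∀ a ∈ T \ I, ∀ b ∈ T \ I, a * b ∈ T \ I := by
  have : Finite Mᵐᵒᵖ := Finite.of_injective _ MulOpposite.unop_injective
  have HR : ∀ x y : Mᵐᵒᵖ,
      StartsCycle ((MulOpposite.unop ⁻¹' T) \ (MulOpposite.unop ⁻¹' I)) x y →
      (∃ u, y = x * u) → x * x ∉ MulOpposite.unop ⁻¹' I := by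
    rintro x y hc ⟨u, rfl⟩
    exact HL _ _ (StartsCycle.unop (J := T \ I) hc) ⟨u.unop, by simp⟩
  have hx : x ∈ T \ I := by
    obtain ⟨w, hw⟩ := hc
    exact (hw 0).2.1
  have h1 := h.op.mul_mem_of_startsCycle HR (u := MulOpposite.op u) hc.op (by simp [hu])
  intro a ha b hb
  exact h.op.mul_mem_of_forall_mul_mem HR (x := MulOpposite.op x) hx h1
    (MulOpposite.op b) hb (MulOpposite.op a) ha

theorem mul_mem [Finite M] (h : IsPrincipalFactor T I)
    (HR : ∀ x y, StartsCycle (T \ I) x y → (∃ u, y = x * u) → x * x ∉ I)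
    (HL : ∀ x y, StartsCycle (T \ I) x y → (∃ u, y = u * x) → x * x ∉ I)
    {x y : M} {w : ℕ → M} (hT : ∀ n, w n ∈ T ∨ w n = 1)
    (hw : ∀ n, (malcevMonoid x y w n).1 ≠ (malcevMonoid x y w n).2 ∧
      (malcevMonoid x y w n).1 ∈ T \ I ∧ (malcevMonoid x y w n).2 ∈ T \ I) :
    ∀ a ∈ T \ I, ∀ b ∈ T \ I, a * b ∈ T \ I := by
  have hx : x ∈ T \ I := (hw 0).2.1
  have hy : y ∈ T \ I := (hw 0).2.2
  obtain ⟨s, hs, hxs, hys, hsx, hsy⟩ : ∃ s ∈ T \ I,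
      x * s ∈ T \ I ∧ y * s ∈ T \ I ∧ s * x ∈ T \ I ∧ s * y ∈ T \ I := by
    obtain ⟨-, h1, h2⟩ := hw 1
    obtain ⟨-, h3, h4⟩ := hw 2
    simp only [malcevMonoid] at h1 h2 h3 h4
    have mid : ∀ {a b c : M}, a * b * c ∈ T \ I → b ∈ T → b ∈ T \ I := fun hm hb =>
      ⟨hb, fun hI => hm.2 (h.right_I _ (h.left_I _ hI _) _)⟩
    have mid' : ∀ {a b c : M}, b ∈ T → a * (b * c) ∈ T \ I → b ∈ T \ I := fun {a b c} hb hm =>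
      mid (a := a) (c := c) (by rwa [mul_assoc]) hb
    rcases hT 0 with h0 | h0
    · exact ⟨w 0, mid h1 h0, h.mem_of_mul_right (h.right_T _ hx.1 _) h1,
        h.mem_of_mul_right (h.right_T _ hy.1 _) h2,
        h.mem_of_mul_left (h.left_T _ hx.1 _) (mul_assoc y _ x ▸ h2),
        h.mem_of_mul_left (h.left_T _ hy.1 _) (mul_assoc x _ y ▸ h1)⟩
    rw [h0] at h1 h2 h3 h4
    simp only [mul_one] at h1 h2 h3 h4
    rcases hT 1 with h5 | h5
    · refine ⟨w 1, mid h3 h5, ?_, ?_, ?_, ?_⟩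
      · exact mid' (a := y) (c := x * y) (h.right_T _ hx.1 _)
          (by simpa only [mul_assoc] using h4)
      · exact mid' (a := x) (c := y * x) (h.right_T _ hy.1 _)
          (by simpa only [mul_assoc] using h3)
      · exact mid (a := y * x) (c := y) (by simpa only [mul_assoc] using h4)
          (h.left_T _ hx.1 _)
      · exact mid (a := x * y) (c := x) (by simpa only [mul_assoc] using h3)
          (h.left_T _ hy.1 _)
    · rw [h5] at h3 h4
      simp only [mul_one] at h3 h4
      refine ⟨x, hx, ?_, h2, ?_, h1⟩ <;>
      exact mid (a := y) (c := y) (by simpa only [mul_assoc] using h4) (h.left_T _ hx.1 _)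
  by_cases hq : ∃ q, x = q * y
  · obtain ⟨q, hq⟩ := hq
    exact h.mul_mem_of_startsCycle_left HL (StartsCycle.symm ⟨w, hw⟩) hq
  have hsys : s * y * s ∈ T \ I := h.mul_mul_mem hy hsy hys
  have hc : x * (s * y) ∈ T \ I := by
    rw [← mul_assoc]
    exact h.mul_mul_mem hs hxs hsy
  have hcs : x * (s * y) * s ∈ T \ I := h.mul_mul_mem (b := s * y) hsy hc hsys
  have hsc : s * (x * (s * y)) ∈ T \ I := by
    rw [← mul_assoc]
    exact h.mul_mul_mem hx hsx hc
  have hcyc : StartsCycle (T \ I) x (x * (s * y)) :=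
    h.startsCycle_const hx hc hs hxs hcs hsx hsc
      fun ⟨q, e⟩ => hq ⟨q * x * s, by simpa only [mul_assoc] using e⟩
  exact h.mul_mem_of_forall_mul_mem HR hx (h.mul_mem_of_startsCycle HR hcyc rfl)

end IsPrincipalFactor

section Malcev

theorem malcev_add (x y : S) (w : ℕ → Option S) (t k : ℕ) :
    malcev x y w (t + k) =
      malcev (malcev x y w t).1 (malcev x y w t).2 (fun k => w (t + k)) k := by
  induction k with
  | zero => rfl
  | succ k ih =>
    rw [← add_assoc]
    simp only [malcev, ih]

theorem mulW_mem (A : Subsemigroup S) {a b : S} {w : Option S} (ha : a ∈ A) (hb : b ∈ A)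
    (hw : ∀ c, w = some c → c ∈ A) : mulW a w b ∈ A := by
  cases w with
  | none => exact A.mul_mem ha hb
  | some c => exact A.mul_mem (A.mul_mem ha (hw c rfl)) hb

theorem malcev_mem (A : Subsemigroup S) {x y : S} {w : ℕ → Option S} (hx : x ∈ A) (hy : y ∈ A)
    {n : ℕ} (hw : ∀ k < n, ∀ c, w k = some c → c ∈ A) :
    (malcev x y w n).1 ∈ A ∧ (malcev x y w n).2 ∈ A := by
  induction n with
  | zero => exact ⟨hx, hy⟩
  | succ n ih =>
    obtain ⟨h1, h2⟩ := ih fun k hk => hw k (by omega)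
    exact ⟨mulW_mem A h1 h2 (hw n (by omega)), mulW_mem A h2 h1 (hw n (by omega))⟩

theorem mulW_mem_of_left {I : Set S} (hI : IsIdealIn Set.univ I) {a b : S} {w : Option S}
    (ha : a ∈ I) : mulW a w b ∈ I := by
  cases w with
  | none => exact (hI.2 _ ha _ trivial).2
  | some c => exact (hI.2 _ (hI.2 _ ha _ trivial).2 _ trivial).2

theorem mulW_mem_of_right {I : Set S} (hI : IsIdealIn Set.univ I) {a b : S} {w : Option S}
    (hb : b ∈ I) : mulW a w b ∈ I := by
  cases w with
  | none => exact (hI.2 _ hb _ trivial).1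
  | some c => exact (hI.2 _ hb _ trivial).1

theorem malcev_add_mem {I : Set S} (hI : IsIdealIn Set.univ I) {x y : S} {w : ℕ → Option S}
    {t : ℕ} (h : (malcev x y w t).1 ∈ I ∨ (malcev x y w t).2 ∈ I) (k : ℕ) :
    (malcev x y w (t + (k + 1))).1 ∈ I ∧ (malcev x y w (t + (k + 1))).2 ∈ I := by
  induction k with
  | zero =>
    rcases h with h | h
    · exact ⟨mulW_mem_of_left hI h, mulW_mem_of_right hI h⟩
    · exact ⟨mulW_mem_of_right hI h, mulW_mem_of_left hI h⟩
  | succ k ih => exact ⟨mulW_mem_of_left hI ih.1, mulW_mem_of_left hI ih.2⟩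

theorem malcev_add_eq {x y : S} {w : ℕ → Option S} {t : ℕ}
    (h : (malcev x y w t).1 = (malcev x y w t).2) (k : ℕ) :
    (malcev x y w (t + k)).1 = (malcev x y w (t + k)).2 := by
  induction k with
  | zero => exact h
  | succ k ih =>
    rw [← add_assoc]
    simp only [malcev, ih]

/-- A failure of nilpotency modulo an ideal of a finite semigroup is witnessed by a single
infinite Mal'cev sequence. -/
theorem exists_malcev_ne [Finite S] {I : Set S} (hI : IsIdealIn Set.univ I) {A : Subsemigroup S}
    (h : ¬ SetMNMod I (A : Set S)) :
    ∃ x ∈ A, ∃ y ∈ A, ∃ w : ℕ → Option S, (∀ k c, w k = some c → c ∈ A) ∧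
      ∀ n, (malcev x y w n).1 ≠ (malcev x y w n).2 ∧
        (malcev x y w n).1 ∉ I ∧ (malcev x y w n).2 ∉ I := by
  unfold SetMNMod at h
  push Not at h
  obtain ⟨x, hx, y, hy, w, hw, hn⟩ := h (Nat.card (S × S) + 1) (Nat.succ_pos _)
  obtain ⟨t, m, htm, hm, e⟩ : ∃ t m, t < m ∧ m ≤ Nat.card (S × S) ∧
      malcev x y w t = malcev x y w m := by
    have := Fintype.ofFinite (S × S)
    obtain ⟨a, b, hab, e⟩ := Fintype.exists_ne_map_eq_of_card_lt
      (fun k : Fin (Nat.card (S × S) + 1) => malcev x y w k) (by simp)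
    rcases lt_or_gt_of_ne hab with hlt | hlt
    · exact ⟨a, b, hlt, by omega, e⟩
    · exact ⟨b, a, hlt, by omega, e.symm⟩
  have hgood : ∀ k ≤ Nat.card (S × S), (malcev x y w k).1 ≠ (malcev x y w k).2 ∧
      (malcev x y w k).1 ∉ I ∧ (malcev x y w k).2 ∉ I := by
    intro k hk
    obtain ⟨l, hl⟩ := Nat.exists_eq_add_of_le hk
    refine ⟨fun e => hn (Or.inl ?_), fun e => hn (Or.inr ?_), fun e => hn (Or.inr ?_)⟩
    · rw [hl, add_assoc]
      exact malcev_add_eq e _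
    · rw [hl, add_assoc]
      exact malcev_add_mem hI (Or.inl e) _
    · rw [hl, add_assoc]
      exact malcev_add_mem hI (Or.inr e) _
  have hmem := malcev_mem A hx hy (n := t) fun k _ => hw k
  refine ⟨_, hmem.1, _, hmem.2, fun k => w (t + k % (m - t)), fun k => hw _, fun n => ?_⟩
  have key : malcev (malcev x y w t).1 (malcev x y w t).2 (fun k => w (t + k % (m - t))) n =
      malcev x y w (t + n % (m - t)) := by
    induction n with
    | zero => simp [malcev]
    | succ n ih =>
      have h1 : malcev x y w (t + n % (m - t) + 1) =
          malcev x y w (t + (n + 1) % (m - t)) := by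
        have hlt := Nat.mod_lt n (show m - t > 0 by omega)
        rw [← Nat.mod_add_mod n (m - t) 1]
        rcases Nat.lt_or_eq_of_le (Nat.succ_le_of_lt hlt) with h2 | h2
        · rw [Nat.mod_eq_of_lt h2, add_assoc]
        · rw [show n % (m - t) + 1 = m - t from h2, Nat.mod_self, add_zero, e]
          congr 1
          omega
      rw [← h1]
      simp only [malcev, ih]
  rw [key]
  have hlt := Nat.mod_lt n (show m - t > 0 by omega)
  exact hgood _ (by omega)

/-- In a pseudo-nilpotent finite semigroup the two initial terms of a Mal'cev sequence that
never collapses modulo `I` generate a semigroup that is not nilpotent modulo `I`. -/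
theorem IsPN.not_setMNMod [Finite S] (hPN : IsPN S) {I : Set S} (hI : IsIdealIn Set.univ I)
    {x y : S} {w : ℕ → Option S}
    (hw : ∀ n, (malcev x y w n).1 ≠ (malcev x y w n).2 ∧
      (malcev x y w n).1 ∉ I ∧ (malcev x y w n).2 ∉ I) :
    ¬ SetMNMod I (Subsemigroup.closure {x, y} : Set S) := by
  obtain ⟨t, m, htm, e⟩ : ∃ t m, t < m ∧ malcev x y w t = malcev x y w m := by
    obtain ⟨a, b, hab, e⟩ := Finite.exists_ne_map_eq_of_infinite (malcev x y w)
    rcases lt_or_gt_of_ne hab with hlt | hlt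
    · exact ⟨a, b, hlt, e⟩
    · exact ⟨b, a, hlt, e.symm⟩
  rintro ⟨n, hn0, hn⟩
  have hle : Subsemigroup.closure {x, y} ≤ Subsemigroup.closure (genSet x y w m) :=
    Subsemigroup.closure_mono Set.subset_union_left
  refine hPN x y w m (I ∩ Subsemigroup.closure (genSet x y w m)) ?_ (fun h => (hw m).2.1 h.1)
    (fun h => (hw m).2.2 h.1) ⟨t, htm, (hw t).1, e⟩ 0 (Nat.zero_le _) ⟨n, hn0, ?_⟩
  · refine ⟨Set.inter_subset_right, fun a ha t ht => ?_⟩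
    exact ⟨⟨(hI.2 _ ha.1 _ trivial).1, Subsemigroup.mul_mem _ ht ha.2⟩,
      ⟨(hI.2 _ ha.1 _ trivial).2, Subsemigroup.mul_mem _ ha.2 ht⟩⟩
  · intro p hp q hq v hv
    have hmem := malcev_mem (Subsemigroup.closure {x, y}) hp hq (n := n) fun k _ => hv k
    rcases hn p hp q hq v hv with h | h
    · exact Or.inl h
    · exact Or.inr ⟨⟨h.1, hle hmem.1⟩, ⟨h.2, hle hmem.2⟩⟩

theorem commute_of_mem_closure_singleton {a p q : S} (hp : p ∈ Subsemigroup.closure {a})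
    (hq : q ∈ Subsemigroup.closure {a}) : Commute p q := by
  induction hp, hq using Subsemigroup.closure_induction₂ with
  | mem x y hx hy =>
    rw [Set.mem_singleton_iff] at hx hy
    rw [hx, hy]
  | mul_left x y z _ _ _ h1 h2 => exact h1.mul_left h2
  | mul_right x y z _ _ _ h1 h2 => exact h1.mul_right h2

theorem mulW_comm_of_mem_closure_singleton {a p q : S} {w : Option S}
    (hp : p ∈ Subsemigroup.closure {a}) (hq : q ∈ Subsemigroup.closure {a})
    (hw : ∀ c, w = some c → c ∈ Subsemigroup.closure {a}) : mulW p w q = mulW q w p := by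
  cases w with
  | none => exact commute_of_mem_closure_singleton hp hq
  | some c =>
    have hc := hw c rfl
    change p * c * q = q * c * p
    rw [mul_assoc q, ← commute_of_mem_closure_singleton hp hc]
    exact commute_of_mem_closure_singleton (Subsemigroup.mul_mem _ hp hc) hq

/-- A semigroup all of whose elements are powers of `a`, left annihilators or right annihilators
modulo `I` is nilpotent modulo `I`. -/
theorem setMNMod_of_forall {I : Set S} (hI : IsIdealIn Set.univ I) {A : Subsemigroup S} (a : S)
    (hA : ∀ z ∈ A, z ∈ Subsemigroup.closure {a} ∨ (∀ g ∈ A, z * g ∈ I) ∨ ∀ g ∈ A, g * z ∈ I) :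
    SetMNMod I (A : Set S) := by
  refine ⟨2, by norm_num, fun p hp q hq w hw => ?_⟩
  have key : (malcev p q w 1).1 = (malcev p q w 1).2 ∨
      ((malcev p q w 1).1 ∈ I ∨ (malcev p q w 1).2 ∈ I) := by
    change mulW p (w 0) q = mulW q (w 0) p ∨ (mulW p (w 0) q ∈ I ∨ mulW q (w 0) p ∈ I)
    have ideal_left : ∀ {u}, u ∈ I → ∀ t, t * u ∈ I := fun hu t => (hI.2 _ hu t trivial).1
    have ideal_right : ∀ {u}, u ∈ I → ∀ t, u * t ∈ I := fun hu t => (hI.2 _ hu t trivial).2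
    cases h0 : w 0 with
    | none =>
      rcases hA p hp with h1 | h1 | h1
      · rcases hA q hq with h2 | h2 | h2
        · exact Or.inl (mulW_comm_of_mem_closure_singleton h1 h2 (by simp))
        · exact Or.inr (Or.inr (h2 p hp))
        · exact Or.inr (Or.inl (h2 p hp))
      · exact Or.inr (Or.inl (h1 q hq))
      · exact Or.inr (Or.inr (h1 q hq))
    | some c =>
      have hc : c ∈ A := hw 0 c h0
      rcases hA p hp with h1 | h1 | h1
      · rcases hA q hq with h2 | h2 | h2
        · rcases hA c hc with h3 | h3 | h3
          · exact Or.inl (mulW_comm_of_mem_closure_singleton h1 h2 (by simpa using h3))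
          · refine Or.inr (Or.inl ?_)
            change p * c * q ∈ I
            rw [mul_assoc]
            exact ideal_left (h3 q hq) p
          · exact Or.inr (Or.inl (ideal_right (h3 p hp) q))
        · exact Or.inr (Or.inr (ideal_right (h2 c hc) p))
        · exact Or.inr (Or.inl (h2 _ (A.mul_mem hp hc)))
      · exact Or.inr (Or.inl (ideal_right (h1 c hc) q))
      · exact Or.inr (Or.inr (h1 _ (A.mul_mem hq hc)))
  rcases key with h | h
  · exact Or.inl (malcev_add_eq h 1)
  · exact Or.inr (malcev_add_mem hI h 0)

theorem setMNMod_closure_pair_of_left {I : Set S} (hI : IsIdealIn Set.univ I) {x y : S}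
    (hxx : x * x ∈ I) (hxy : x * y ∈ I) :
    SetMNMod I (Subsemigroup.closure {x, y} : Set S) := by
  have hx : ∀ g ∈ Subsemigroup.closure {x, y}, x * g ∈ I := by
    intro g hg
    induction hg using Subsemigroup.closure_induction with
    | mem z hz =>
      rcases hz with rfl | rfl
      · exact hxx
      · exact hxy
    | mul z z' _ _ h1 _ =>
      rw [← mul_assoc]
      exact (hI.2 _ h1 _ trivial).2
  refine setMNMod_of_forall hI y fun z hz => ?_
  suffices h : z ∈ Subsemigroup.closure {y} ∨ ∀ g ∈ Subsemigroup.closure {x, y}, z * g ∈ I from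
    h.imp_right Or.inl
  induction hz using Subsemigroup.closure_induction with
  | mem z hz =>
    rcases hz with rfl | rfl
    · exact Or.inr hx
    · exact Or.inl (Subsemigroup.subset_closure rfl)
  | mul z z' _ hz' h1 h2 =>
    rcases h2 with h2 | h2
    · rcases h1 with h1 | h1
      · exact Or.inl (Subsemigroup.mul_mem _ h1 h2)
      · refine Or.inr fun g hg => ?_
        rw [mul_assoc]
        exact h1 _ (Subsemigroup.mul_mem _ hz' hg)
    · refine Or.inr fun g hg => ?_
      rw [mul_assoc]
      exact (hI.2 _ (h2 g hg) _ trivial).1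

theorem setMNMod_closure_pair_of_right {I : Set S} (hI : IsIdealIn Set.univ I) {x y : S}
    (hxx : x * x ∈ I) (hyx : y * x ∈ I) :
    SetMNMod I (Subsemigroup.closure {x, y} : Set S) := by
  have hx : ∀ g ∈ Subsemigroup.closure {x, y}, g * x ∈ I := by
    intro g hg
    induction hg using Subsemigroup.closure_induction with
    | mem z hz =>
      rcases hz with rfl | rfl
      · exact hxx
      · exact hyx
    | mul z z' _ _ _ h1 =>
      rw [mul_assoc]
      exact (hI.2 _ h1 _ trivial).1
  refine setMNMod_of_forall hI y fun z hz => ?_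
  suffices h : z ∈ Subsemigroup.closure {y} ∨ ∀ g ∈ Subsemigroup.closure {x, y}, g * z ∈ I from
    h.imp_right Or.inr
  induction hz using Subsemigroup.closure_induction with
  | mem z hz =>
    rcases hz with rfl | rfl
    · exact Or.inr hx
    · exact Or.inl (Subsemigroup.subset_closure rfl)
  | mul z z' hz _ h1 h2 =>
    rcases h1 with h1 | h1
    · rcases h2 with h2 | h2
      · exact Or.inl (Subsemigroup.mul_mem _ h1 h2)
      · refine Or.inr fun g hg => ?_
        rw [← mul_assoc]
        exact h2 _ (Subsemigroup.mul_mem _ hg hz)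
    · refine Or.inr fun g hg => ?_
      rw [← mul_assoc]
      exact (hI.2 _ (h1 g hg) _ trivial).2

/-- Let `P` be the complement of a prime-like subset and `¬ P b`.  A Mal'cev sequence in
`⟨a, b⟩` whose first step satisfies `P` only involves powers of `a`. -/
theorem malcev_one_eq_of_closed {P : S → Prop} (hP : ∀ p q, P (p * q) → P p ∧ P q) {a b : S}
    (hb : ¬ P b) {x y : S} {w : ℕ → Option S} (hx : x ∈ Subsemigroup.closure {a, b})
    (hy : y ∈ Subsemigroup.closure {a, b})
    (hw : ∀ c, w 0 = some c → c ∈ Subsemigroup.closure {a, b}) (h : P (malcev x y w 1).1) :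
    (malcev x y w 1).1 = (malcev x y w 1).2 := by
  have key : ∀ z ∈ Subsemigroup.closure {a, b}, P z → z ∈ Subsemigroup.closure {a} := by
    intro z hz
    induction hz using Subsemigroup.closure_induction with
    | mem z hz =>
      rcases hz with rfl | rfl
      · exact fun _ => Subsemigroup.subset_closure rfl
      · exact fun h => absurd h hb
    | mul z z' _ _ h1 h2 =>
      exact fun h => Subsemigroup.mul_mem _ (h1 (hP _ _ h).1) (h2 (hP _ _ h).2)
  change P (mulW x (w 0) y) at h
  change mulW x (w 0) y = mulW y (w 0) x
  cases h0 : w 0 with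
  | none =>
    rw [h0] at h
    exact mulW_comm_of_mem_closure_singleton (key x hx (hP _ _ h).1) (key y hy (hP _ _ h).2)
      (by simp)
  | some c =>
    rw [h0] at h
    have h1 := hP _ _ h
    have h2 := hP _ _ h1.1
    exact mulW_comm_of_mem_closure_singleton (key x hx h2.1) (key y hy h1.2)
      (by simpa using key c (hw c h0) h2.2)

end Malcev

/-- The element of `S¹`, realised as `WithOne S`, described by a parameter. -/
def paramToWithOne : Option S → WithOne S
  | none => 1
  | some c => (c : WithOne S)

theorem coe_mulW (a b : S) (w : Option S) :
    ((mulW a w b : S) : WithOne S) = a * paramToWithOne w * b := by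
  cases w <;> simp [mulW, paramToWithOne]

theorem malcevMonoid_coe (x y : S) (w : ℕ → Option S) (n : ℕ) :
    malcevMonoid (x : WithOne S) y (fun k => paramToWithOne (w k)) n =
      (WithOne.coe (malcev x y w n).1, WithOne.coe (malcev x y w n).2) := by
  induction n with
  | zero => rfl
  | succ n ih => simp only [malcevMonoid, malcev, ih, coe_mulW]

omit [Semigroup S] in
theorem coe_mem_image_diff {A B : Set S} {a : S} :
    (a : WithOne S) ∈ (WithOne.coe '' A) \ (WithOne.coe '' B) ↔ a ∈ A \ B := by
  simp [WithOne.coe_injective.mem_set_image]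

theorem exists_malcev_of_startsCycle {T I : Set S} {x y : S}
    (h : StartsCycle ((WithOne.coe '' T) \ (WithOne.coe '' I)) (x : WithOne S) y) :
    ∃ w : ℕ → Option S, ∀ n, (malcev x y w n).1 ≠ (malcev x y w n).2 ∧
      (malcev x y w n).1 ∉ I ∧ (malcev x y w n).2 ∉ I := by
  obtain ⟨w, hw⟩ := h
  have hsurj : ∀ z : WithOne S, ∃ o, paramToWithOne o = z := by
    intro z
    induction z with
    | one => exact ⟨none, rfl⟩
    | coe c => exact ⟨some c, rfl⟩
  choose f hf using hsurj
  refine ⟨fun k => f (w k), fun n => ?_⟩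
  have e := malcevMonoid_coe x y (fun k => f (w k)) n
  simp only [hf] at e
  obtain ⟨h1, h2, h3⟩ := hw n
  rw [e] at h1 h2 h3
  exact ⟨fun h => h1 (congrArg _ h), (coe_mem_image_diff.1 h2).2, (coe_mem_image_diff.1 h3).2⟩

namespace PrincipalSeries

variable (ps : PrincipalSeries S)

theorem isIdealIn {i : ℕ} (h1 : 1 ≤ i) (hm : i ≤ ps.m + 1) : IsIdealIn Set.univ (ps.C i) := by
  rcases Nat.lt_or_eq_of_le hm with h | rfl
  · exact ps.ideal i h1 (by omega)
  · rw [ps.last]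
    exact ⟨Set.empty_subset _, fun a ha => absurd ha (Set.notMem_empty a)⟩

theorem antitone {i j : ℕ} (h1 : 1 ≤ i) (hij : i ≤ j) (hm : j ≤ ps.m + 1) :
    ps.C j ⊆ ps.C i := by
  induction j, hij using Nat.le_induction with
  | base => exact subset_rfl
  | succ j hij ih => exact (ps.ssub j (by omega) (by omega)).1.trans (ih (by omega))

theorem exists_mem_diff (a : S) : ∃ i, 1 ≤ i ∧ i ≤ ps.m ∧ a ∈ ps.C i \ ps.C (i + 1) := by
  by_contra! h
  have key : ∀ k ≤ ps.m, a ∈ ps.C (k + 1) := by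
    intro k hk
    induction k with
    | zero => simp [ps.first]
    | succ k ih =>
      by_contra hn
      exact h (k + 1) (by omega) (by omega) ⟨ih (by omega), hn⟩
  have := key ps.m le_rfl
  rw [ps.last] at this
  exact this

theorem eq_of_mem_diff {i j : ℕ} (hi : 1 ≤ i) (him : i ≤ ps.m) (hj : 1 ≤ j) (hjm : j ≤ ps.m)
    {a : S} (ha : a ∈ ps.C i \ ps.C (i + 1)) (ha' : a ∈ ps.C j \ ps.C (j + 1)) : i = j := by
  rcases lt_trichotomy i j with h | h | h
  · exact absurd (ps.antitone (by omega) h (by omega) ha'.1) ha.2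
  · exact h
  · exact absurd (ps.antitone (by omega) h (by omega) ha.1) ha'.2

theorem mul_coe_mem {i : ℕ} (h1 : 1 ≤ i) (hm : i ≤ ps.m + 1) {a z : S} (ha : a ∈ ps.C i)
    {u v : WithOne S} (hz : (z : WithOne S) = u * a * v) : z ∈ ps.C i := by
  have hI := ps.isIdealIn h1 hm
  induction u with
  | one =>
    induction v with
    | one => simp_all
    | coe v =>
      rw [one_mul, ← WithOne.coe_mul, WithOne.coe_inj] at hz
      exact hz ▸ (hI.2 _ ha _ trivial).2
  | coe u =>
    induction v with
    | one =>
      rw [mul_one, ← WithOne.coe_mul, WithOne.coe_inj] at hz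
      exact hz ▸ (hI.2 _ ha _ trivial).1
    | coe v =>
      rw [← WithOne.coe_mul, ← WithOne.coe_mul, WithOne.coe_inj] at hz
      exact hz ▸ (hI.2 _ (hI.2 _ ha _ trivial).1 _ trivial).2

theorem exists_eq_mul_mul {i : ℕ} (h1 : 1 ≤ i) (hm : i ≤ ps.m) {c d : S}
    (hc : c ∈ ps.C i \ ps.C (i + 1)) (hd : d ∈ ps.C i \ ps.C (i + 1)) :
    ∃ u v : WithOne S, (c : WithOne S) = u * d * v := by
  let D : Set S := ps.C (i + 1) ∪ {z | ∃ u v : WithOne S, (z : WithOne S) = u * d * v}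
  have hD : IsIdealIn Set.univ D := by
    refine ⟨Set.subset_univ _, ?_⟩
    rintro a (ha | ⟨u, v, e⟩) t -
    · have hI := ps.isIdealIn (i := i + 1) (by omega) (by omega)
      exact ⟨Or.inl (hI.2 _ ha _ trivial).1, Or.inl (hI.2 _ ha _ trivial).2⟩
    · refine ⟨Or.inr ⟨t * u, v, ?_⟩, Or.inr ⟨u, v * t, ?_⟩⟩ <;>
        rw [WithOne.coe_mul, e] <;> simp only [mul_assoc]
  rcases ps.maximal i h1 hm D hD Set.subset_union_left
    (Set.union_subset (ps.ssub i h1 hm).1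
      fun z ⟨u, v, e⟩ => ps.mul_coe_mem h1 (by omega) hd.1 e) with h | h
  · exact absurd (h ▸ (Or.inr ⟨1, 1, by simp⟩ : d ∈ D)) hd.2
  · have : c ∈ D := h ▸ hc.1
    exact this.resolve_left hc.2

theorem isPrincipalFactor {i : ℕ} (h1 : 1 ≤ i) (hm : i ≤ ps.m) :
    IsPrincipalFactor (WithOne.coe '' ps.C i) (WithOne.coe '' ps.C (i + 1)) := by
  have left : ∀ j, 1 ≤ j → j ≤ ps.m + 1 → ∀ a ∈ WithOne.coe '' ps.C j, ∀ u : WithOne S,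
      u * a ∈ WithOne.coe '' ps.C j := by
    rintro j hj hjm _ ⟨a, ha, rfl⟩ u
    induction u with
    | one => exact ⟨a, ha, (one_mul _).symm⟩
    | coe u => exact ⟨u * a, ((ps.isIdealIn hj hjm).2 _ ha _ trivial).1, rfl⟩
  have right : ∀ j, 1 ≤ j → j ≤ ps.m + 1 → ∀ a ∈ WithOne.coe '' ps.C j, ∀ u : WithOne S,
      a * u ∈ WithOne.coe '' ps.C j := by
    rintro j hj hjm _ ⟨a, ha, rfl⟩ u
    induction u with
    | one => exact ⟨a, ha, (mul_one _).symm⟩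
    | coe u => exact ⟨a * u, ((ps.isIdealIn hj hjm).2 _ ha _ trivial).2, rfl⟩
  refine ⟨left i h1 (by omega), right i h1 (by omega), left (i + 1) (by omega) (by omega),
    right (i + 1) (by omega) (by omega), ?_⟩
  rintro _ ha _ hb
  obtain ⟨a, -, rfl⟩ := ha.1
  obtain ⟨b, -, rfl⟩ := hb.1
  exact ps.exists_eq_mul_mul h1 hm (coe_mem_image_diff.1 ha) (coe_mem_image_diff.1 hb)

variable {ps}

/-- A principal factor of a pseudo-nilpotent finite semigroup that is not nilpotent has no zero
divisors. -/
theorem mul_mem_diff [Finite S] (hPN : IsPN S) {i : ℕ} (h1 : 1 ≤ i) (hm : i ≤ ps.m)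
    (hn : ¬ SetMNMod (ps.C (i + 1)) (ps.C i)) {a b : S} (ha : a ∈ ps.C i \ ps.C (i + 1))
    (hb : b ∈ ps.C i \ ps.C (i + 1)) : a * b ∈ ps.C i \ ps.C (i + 1) := by
  have hT := ps.isIdealIn h1 (by omega)
  have hI := ps.isIdealIn (i := i + 1) (by omega) (by omega)
  have : Finite (WithOne S) := inferInstanceAs (Finite (Option S))
  let A : Subsemigroup S := ⟨ps.C i, fun ha _ => (hT.2 _ ha _ trivial).2⟩
  obtain ⟨x, hx, y, hy, w, hwA, hw⟩ := exists_malcev_ne hI (A := A) hn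
  have hmem := fun n => malcev_mem A hx hy (n := n) fun k _ => hwA k
  have h := (ps.isPrincipalFactor h1 hm).mul_mem ?_ ?_ (x := (x : WithOne S)) (y := y)
    (w := fun k => paramToWithOne (w k)) ?_ ?_ (a : WithOne S) (coe_mem_image_diff.2 ha) b
    (coe_mem_image_diff.2 hb)
  · exact coe_mem_image_diff.1 h
  · rintro x y hc ⟨u, hu⟩ ⟨z, hz, e⟩
    obtain ⟨x, -, rfl⟩ : x ∈ WithOne.coe '' ps.C i := hc.elim fun w hw => (hw 0).2.1.1
    obtain ⟨y, -, rfl⟩ : y ∈ WithOne.coe '' ps.C i := hc.elim fun w hw => (hw 0).2.2.1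
    obtain ⟨w, hw⟩ := exists_malcev_of_startsCycle hc
    rw [← WithOne.coe_mul, WithOne.coe_inj] at e
    refine hPN.not_setMNMod hI hw (setMNMod_closure_pair_of_left hI (e ▸ hz) ?_)
    refine ps.mul_coe_mem (by omega) (by omega) hz (u := 1) (v := u) ?_
    rw [e, WithOne.coe_mul, hu, WithOne.coe_mul, one_mul, mul_assoc]
  · rintro x y hc ⟨u, hu⟩ ⟨z, hz, e⟩
    obtain ⟨x, -, rfl⟩ : x ∈ WithOne.coe '' ps.C i := hc.elim fun w hw => (hw 0).2.1.1
    obtain ⟨y, -, rfl⟩ : y ∈ WithOne.coe '' ps.C i := hc.elim fun w hw => (hw 0).2.2.1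
    obtain ⟨w, hw⟩ := exists_malcev_of_startsCycle hc
    rw [← WithOne.coe_mul, WithOne.coe_inj] at e
    refine hPN.not_setMNMod hI hw (setMNMod_closure_pair_of_right hI (e ▸ hz) ?_)
    refine ps.mul_coe_mem (by omega) (by omega) hz (u := u) (v := 1) ?_
    rw [e, WithOne.coe_mul, hu, WithOne.coe_mul, mul_one, mul_assoc]
  · intro n
    cases e : w n with
    | none => exact Or.inr rfl
    | some c => exact Or.inl ⟨c, hwA n c e, rfl⟩
  · intro n
    rw [malcevMonoid_coe]
    obtain ⟨h1, h2, h3⟩ := hw n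
    exact ⟨fun h => h1 (WithOne.coe_injective h), coe_mem_image_diff.2 ⟨(hmem n).1, h2⟩,
      coe_mem_image_diff.2 ⟨(hmem n).2, h3⟩⟩

variable (ps)

/-- The elements of `S` that act nontrivially between elements of `S_k \ S_{k+1}`. -/
def support (k : ℕ) : Set S :=
  {s | ∃ p ∈ ps.C k \ ps.C (k + 1), ∃ q ∈ ps.C k \ ps.C (k + 1),
    p * s * q ∈ ps.C k \ ps.C (k + 1)}

variable {ps}

section NotNilpotent

variable [Finite S] (hPN : IsPN S) {k : ℕ} (h1 : 1 ≤ k) (hm : k ≤ ps.m)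
  (hn : ¬ SetMNMod (ps.C (k + 1)) (ps.C k))

include hPN h1 hm hn

theorem mem_support_of_mem_diff {a : S} (ha : a ∈ ps.C k \ ps.C (k + 1)) : a ∈ ps.support k :=
  ⟨a, ha, a, ha, mul_mem_diff hPN h1 hm hn (mul_mem_diff hPN h1 hm hn ha ha) ha⟩

omit [Finite S] hPN hn in
theorem mul_mem_diff_of_mem_support {p q s : S} (hp : p ∈ ps.C k) (hq : q ∈ ps.C k)
    (h : p * s * q ∈ ps.C k \ ps.C (k + 1)) :
    p * s ∈ ps.C k \ ps.C (k + 1) ∧ s * q ∈ ps.C k \ ps.C (k + 1) := by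
  have hT := ps.isIdealIn h1 (by omega)
  have hI := ps.isIdealIn (i := k + 1) (by omega) (by omega)
  refine ⟨⟨(hT.2 _ hp _ trivial).2, fun hc => h.2 (hI.2 _ hc _ trivial).2⟩,
    ⟨(hT.2 _ hq _ trivial).1, fun hc => h.2 ?_⟩⟩
  rw [mul_assoc]
  exact (hI.2 _ hc _ trivial).1

theorem mul_mem_support_iff {a b : S} :
    a * b ∈ ps.support k ↔ a ∈ ps.support k ∧ b ∈ ps.support k := by
  have mulJ {a b : S} := mul_mem_diff hPN h1 hm hn (a := a) (b := b)
  constructor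
  · rintro ⟨p, hp, q, hq, h⟩
    have hT := ps.isIdealIn h1 (by omega)
    have h2 := mul_mem_diff_of_mem_support h1 hm (hT.2 _ hp.1 a trivial).2 hq.1
      (s := b) (by rwa [mul_assoc p])
    have h3 := mul_mem_diff_of_mem_support h1 hm hp.1 (hT.2 _ hq.1 b trivial).1
      (s := a) (by simpa only [mul_assoc] using h)
    have h4 : p * a ∈ ps.C k \ ps.C (k + 1) := h3.1
    exact ⟨⟨p, hp, q, hq, mulJ h4 hq⟩,
      ⟨p, hp, q, hq, by rw [mul_assoc]; exact mulJ hp h2.2⟩⟩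
  · rintro ⟨⟨p, hp, q, hq, h⟩, p', hp', q', hq', h'⟩
    refine ⟨p, hp, q', hq', ?_⟩
    have := mulJ (mul_mem_diff_of_mem_support h1 hm hp.1 hq.1 h).1
      (mul_mem_diff_of_mem_support h1 hm hp'.1 hq'.1 h').2
    simpa only [mul_assoc] using this

theorem mem_support_of_coe_eq {a z : S} {u v : WithOne S} (e : (z : WithOne S) = u * a * v)
    (hz : z ∈ ps.support k) : a ∈ ps.support k := by
  have key := fun {a b} => @mul_mem_support_iff S _ ps _ hPN k h1 hm hn a b
  induction u with
  | one =>
    induction v with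
    | one => simp_all
    | coe v =>
      rw [one_mul, ← WithOne.coe_mul, WithOne.coe_inj] at e
      rw [e] at hz
      exact (key.1 hz).1
  | coe u =>
    induction v with
    | one =>
      rw [mul_one, ← WithOne.coe_mul, WithOne.coe_inj] at e
      rw [e] at hz
      exact (key.1 hz).2
    | coe v =>
      rw [← WithOne.coe_mul, ← WithOne.coe_mul, WithOne.coe_inj] at e
      rw [e] at hz
      exact (key.1 (key.1 hz).1).2

theorem diff_subset_support {i : ℕ} (hi : 1 ≤ i) (him : i ≤ ps.m) {a : S}
    (ha : a ∈ ps.C i \ ps.C (i + 1)) (has : a ∈ ps.support k) :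
    ps.C i \ ps.C (i + 1) ⊆ ps.support k := by
  intro c hc
  obtain ⟨u, v, e⟩ := ps.exists_eq_mul_mul hi him ha hc
  exact mem_support_of_coe_eq hPN h1 hm hn e has

theorem stem_eq_support : Stem ps k = ps.support k := by
  have mulJ {a b : S} := mul_mem_diff hPN h1 hm hn (a := a) (b := b)
  have hT := ps.isIdealIn h1 (by omega)
  have hI := ps.isIdealIn (i := k + 1) (by omega) (by omega)
  ext s
  constructor
  · rintro (⟨-, a, ha, h | h⟩ | h)
    · have haJ : a ∈ ps.C k \ ps.C (k + 1) := ⟨ha, fun hc => h (hI.2 _ hc _ trivial).1⟩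
      refine ⟨a, haJ, a, haJ, ?_⟩
      rw [mul_assoc]
      exact mulJ haJ ⟨(hT.2 _ ha _ trivial).1, h⟩
    · have haJ : a ∈ ps.C k \ ps.C (k + 1) := ⟨ha, fun hc => h (hI.2 _ hc _ trivial).2⟩
      exact ⟨a, haJ, a, haJ, mulJ ⟨(hT.2 _ ha _ trivial).2, h⟩ haJ⟩
    · exact mem_support_of_mem_diff hPN h1 hm hn h
  · rintro ⟨p, hp, q, hq, h⟩
    have h2 := mul_mem_diff_of_mem_support h1 hm hp.1 hq.1 h
    by_cases hs : s ∈ ps.C k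
    · exact Or.inr ⟨hs, fun hc => h2.1.2 (hI.2 _ hc _ trivial).1⟩
    · exact Or.inl ⟨hs, p, hp.1, Or.inr h2.1.2⟩

end NotNilpotent

theorem exists_support_of_nEdge [Finite S] (hPN : IsPN S) {j : ℕ} (h1 : 1 ≤ j) (hm : j ≤ ps.m)
    {a b : S} (hb : b ∈ ps.C (j + 1)) (hab : NEdge a b) :
    ∃ l, j < l ∧ l ≤ ps.m ∧ ¬ SetMNMod (ps.C (l + 1)) (ps.C l) ∧ a ∈ ps.support l := by
  have hempty : IsIdealIn Set.univ (∅ : Set S) := ⟨Set.empty_subset _, fun _ h => h.elim⟩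
  obtain ⟨x, hx, y, hy, w, hwA, hw⟩ := exists_malcev_ne hempty
    (A := Subsemigroup.closure {a, b}) (fun ⟨n, hn0, hn⟩ => hab.2 ⟨n, hn0, fun x hx y hy w hw =>
      (hn x hx y hy w hw).resolve_right fun h => h.1⟩)
  let Q : ℕ → Prop := fun l => 1 ≤ l ∧ l ≤ ps.m ∧ ∃ n, (malcev x y w n).1 ∈ ps.C l
  obtain ⟨l, hQ, hmax⟩ : ∃ l, Q l ∧ ∀ l', Q l' → l' ≤ l := by
    classical
    obtain ⟨i, hi, him, hxi⟩ := ps.exists_mem_diff x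
    have hQi : Q i := ⟨hi, him, 0, hxi.1⟩
    exact ⟨Nat.findGreatest Q ps.m, Nat.findGreatest_spec him hQi,
      fun l' hl' => Nat.le_findGreatest hl'.2.1 hl'⟩
  obtain ⟨hl1, hlm, n₀, hn₀⟩ := hQ
  have hT := ps.isIdealIn hl1 (by omega)
  have hI := ps.isIdealIn (i := l + 1) (by omega) (by omega)
  have hnot : ∀ n, (malcev x y w n).1 ∉ ps.C (l + 1) := by
    intro n hn
    rcases Nat.lt_or_eq_of_le hlm with h | h
    · have := hmax (l + 1) ⟨by omega, h, n, hn⟩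
      omega
    · rw [h, ps.last] at hn
      exact hn
  have hnot' : ∀ n, (malcev x y w n).2 ∉ ps.C (l + 1) := fun n hn =>
    hnot (n + 1) (mulW_mem_of_right hI hn)
  have hmem := malcev_mem (Subsemigroup.closure {a, b}) hx hy (n := n₀ + 1) fun k _ => hwA k
  have hin := malcev_add_mem hT (Or.inl hn₀) 0
  obtain ⟨x', y', w', hx', hy', hw'A, hx'T, hy'T, hw'⟩ : ∃ x' y' : S, ∃ w' : ℕ → Option S,
      x' ∈ Subsemigroup.closure {a, b} ∧ y' ∈ Subsemigroup.closure {a, b} ∧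
      (∀ k c, w' k = some c → c ∈ Subsemigroup.closure {a, b}) ∧ x' ∈ ps.C l ∧ y' ∈ ps.C l ∧
      ∀ n, (malcev x' y' w' n).1 ≠ (malcev x' y' w' n).2 ∧
        (malcev x' y' w' n).1 ∉ ps.C (l + 1) ∧ (malcev x' y' w' n).2 ∉ ps.C (l + 1) := by
    refine ⟨_, _, fun k => w (n₀ + 1 + k), hmem.1, hmem.2, fun k => hwA _, hin.1, hin.2,
      fun n => ?_⟩
    rw [← malcev_add]
    exact ⟨(hw _).1, hnot _, hnot' _⟩
  have hn : ¬ SetMNMod (ps.C (l + 1)) (ps.C l) := by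
    rintro ⟨n, hn0, hn⟩
    have hsub : Subsemigroup.closure {x', y'} ≤
        (⟨ps.C l, fun ha _ => (hT.2 _ ha _ trivial).2⟩ : Subsemigroup S) := by
      rw [Subsemigroup.closure_le]
      rintro z (rfl | rfl)
      · exact hx'T
      · exact hy'T
    exact hPN.not_setMNMod hI hw' ⟨n, hn0, fun p hp q hq v hv =>
      hn p (hsub hp) q (hsub hq) v fun k c hk => hsub (hv k c hk)⟩
  have hlast : (malcev x' y' w' 1).1 ∈ ps.C l \ ps.C (l + 1) :=
    ⟨mulW_mem_of_left hT hx'T, (hw' 1).2.1⟩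
  refine ⟨l, ?_, hlm, hn, ?_⟩
  · by_contra! hlj
    have hJ := ps.isIdealIn (i := j + 1) (by omega) (by omega)
    refine (hw' 1).1 (malcev_one_eq_of_closed (P := (· ∉ ps.C (j + 1))) ?_ (not_not.2 hb) hx' hy'
      (hw'A 0) fun h => hlast.2 (ps.antitone (by omega) (by omega) (by omega) h))
    exact fun p q h => ⟨fun hp => h (hJ.2 _ hp _ trivial).2, fun hq => h (hJ.2 _ hq _ trivial).1⟩
  · by_contra ha
    rw [Set.pair_comm] at hx' hy' hw'A
    exact (hw' 1).1 (malcev_one_eq_of_closed (P := (· ∈ ps.support l))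
      (fun p q => (mul_mem_support_iff hPN hl1 hlm hn).1) ha hx' hy' (hw'A 0)
      (mem_support_of_mem_diff hPN hl1 hlm hn hlast))

theorem exists_root_of_mem_support [Finite S] (hPN : IsPN S) {j : ℕ} (h1 : 1 ≤ j)
    (hm : j ≤ ps.m) (hn : ¬ SetMNMod (ps.C (j + 1)) (ps.C j)) {a : S} (ha : a ∈ ps.support j) :
    ∃ k, 1 ≤ k ∧ k ≤ ps.m ∧ Root ps k ∧ a ∈ Stem ps k := by
  induction hd : ps.m - j using Nat.strong_induction_on generalizing j with
  | _ d ih =>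
    by_cases hr : Root ps j
    · exact ⟨j, h1, hm, hr, by rwa [stem_eq_support hPN h1 hm hn]⟩
    have hr' : ∃ c ∈ ps.C j \ ps.C (j + 1), ∃ b ∈ ps.C (j + 1), NEdge c b := by
      by_contra! h
      exact hr ⟨hn, h⟩
    obtain ⟨c, hc, b, hb, hcb⟩ := hr'
    obtain ⟨l, hjl, hlm, hnl, hcl⟩ := exists_support_of_nEdge hPN h1 hm hb hcb
    have hl1 : 1 ≤ l := by omega
    obtain ⟨p, hp, q, hq, h⟩ := ha
    have hJ := diff_subset_support hPN hl1 hlm hnl h1 hm hc hcl h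
    have hal := ((mul_mem_support_iff hPN hl1 hlm hnl).1
      ((mul_mem_support_iff hPN hl1 hlm hnl).1 hJ).1).2
    exact ih (ps.m - l) (by omega) hl1 hlm hnl hal rfl

theorem mem_kset_iff [Finite S] (hPN : IsPN S) {a : S} :
    a ∈ Kset ps ↔ ¬ ∃ k, 1 ≤ k ∧ k ≤ ps.m ∧ Root ps k ∧ a ∈ Stem ps k := by
  constructor
  · rintro ⟨i, hi, him, hiso, ha⟩ ⟨k, hk, hkm, hr, hak⟩
    rcases hak with hF | hJ
    · refine hr.1 (hiso.2 k hk hkm fun c hc => ?_)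
      have hak : a ∈ ps.support k := by
        rw [← stem_eq_support hPN hk hkm hr.1]
        exact Or.inl hF
      have hck : c ∈ Stem ps k := by
        rw [stem_eq_support hPN hk hkm hr.1]
        exact diff_subset_support hPN hk hkm hr.1 hi him ha hak hc
      refine hck.resolve_right fun hcJ => hF.1 ?_
      exact ps.eq_of_mem_diff hi him hk hkm hc hcJ ▸ ha.1
    · exact hiso.1 (ps.eq_of_mem_diff hi him hk hkm ha hJ ▸ hr)
  · intro h
    obtain ⟨i, hi, him, ha⟩ := ps.exists_mem_diff a
    refine ⟨i, hi, him, ⟨fun hr => h ⟨i, hi, him, hr, Or.inr ha⟩, fun j hj hjm hsub => ?_⟩, ha⟩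
    by_contra hn
    refine h (exists_root_of_mem_support hPN hj hjm hn ?_)
    rw [← stem_eq_support hPN hj hjm hn]
    exact Or.inl (hsub ha)

end PrincipalSeries

/-- Every stem of a pseudo-nilpotent finite semigroup is a subsemigroup, and for
non-isolated principal factor complements:
`(S_i \ S_{i+1})(S_j \ S_{j+1}) ⊆ K` iff `S_i \ S_{i+1}` and `S_j \ S_{j+1}` are
not contained in a common stem. -/
theorem stmt15 {S : Type*} [Semigroup S] [Finite S] [Nonempty S]
    (hPN : IsPN S) (ps : PrincipalSeries S) :
    (∀ i, 1 ≤ i → i ≤ ps.m → Root ps i →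
      ∀ a ∈ Stem ps i, ∀ b ∈ Stem ps i, a * b ∈ Stem ps i) ∧
    (∀ i j, 1 ≤ i → i ≤ ps.m → 1 ≤ j → j ≤ ps.m →
      ¬ Isolated ps i → ¬ Isolated ps j →
      ((∀ a ∈ ps.C i \ ps.C (i + 1), ∀ b ∈ ps.C j \ ps.C (j + 1),
          a * b ∈ Kset ps) ↔
        ¬ ∃ k, 1 ≤ k ∧ k ≤ ps.m ∧ Root ps k ∧
          ps.C i \ ps.C (i + 1) ⊆ Stem ps k ∧
          ps.C j \ ps.C (j + 1) ⊆ Stem ps k)) := by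
  have iff_mul : ∀ {k}, 1 ≤ k → k ≤ ps.m → Root ps k → ∀ {a b : S},
      a * b ∈ Stem ps k ↔ a ∈ Stem ps k ∧ b ∈ Stem ps k := by
    intro k hk hkm hr a b
    rw [PrincipalSeries.stem_eq_support hPN hk hkm hr.1]
    exact PrincipalSeries.mul_mem_support_iff hPN hk hkm hr.1
  have subset : ∀ {k}, 1 ≤ k → k ≤ ps.m → Root ps k → ∀ {i}, 1 ≤ i → i ≤ ps.m → ∀ {a : S},
      a ∈ ps.C i \ ps.C (i + 1) → a ∈ Stem ps k → ps.C i \ ps.C (i + 1) ⊆ Stem ps k := by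
    intro k hk hkm hr i hi him a ha hak
    rw [PrincipalSeries.stem_eq_support hPN hk hkm hr.1] at hak ⊢
    exact PrincipalSeries.diff_subset_support hPN hk hkm hr.1 hi him ha hak
  refine ⟨fun i hi him hr a ha b hb => (iff_mul hi him hr).2 ⟨ha, hb⟩,
    fun i j hi him hj hjm _ _ => ⟨?_, ?_⟩⟩
  · rintro h ⟨k, hk, hkm, hr, hik, hjk⟩
    obtain ⟨a, ha⟩ := Set.nonempty_of_ssubset (ps.ssub i hi him)
    obtain ⟨b, hb⟩ := Set.nonempty_of_ssubset (ps.ssub j hj hjm)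
    exact (PrincipalSeries.mem_kset_iff hPN).1 (h a ha b hb)
      ⟨k, hk, hkm, hr, (iff_mul hk hkm hr).2 ⟨hik ha, hjk hb⟩⟩
  · intro h a ha b hb
    refine (PrincipalSeries.mem_kset_iff hPN).2 fun ⟨k, hk, hkm, hr, hab⟩ => h ?_
    obtain ⟨hak, hbk⟩ := (iff_mul hk hkm hr).1 hab
    exact ⟨k, hk, hkm, hr, subset hk hkm hr hi him ha hak, subset hk hkm hr hj hjm hb hbk⟩
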